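/- For every integer k ≥ 2 there exists a constant C_k (depending only on k) such that for every smooth (C^∞) function f on the square K̂ = [−1,1]² and every tensor-product Gauss–Lobatto point (s*, t*) of K̂ (i.e., s* and t* are roots of M_{k+1}), the Q^k M-type projection satisfies the superapproximation bound |f(s*, t*) − f_{k,k}(s*, t*)| ≤ C_k [f]_{k+2}, where [f]_{k+2} = ( ∬_{K̂} (∂_s^{k+2} f)² ds dt + ∬_{K̂} (∂_t^{k+2} f)² ds dt )^{1/2}. -/

import Mathlib

open intervalIntegral

/-- The Legendre polynomial `l_j(t) = (1/(2^j j!)) (d/dt)^j (t²−1)^j`. -/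
noncomputable def legendreP (j : ℕ) (t : ℝ) : ℝ :=
  (1 / (2 ^ j * (Nat.factorial j : ℝ))) * iteratedDeriv j (fun x : ℝ => (x ^ 2 - 1) ^ j) t

/-- The M-type polynomials: `M_0(t) = 1`, `M_1(t) = t`, and
    `M_{k+1}(t) = (1/(2^k k!)) (d/dt)^{k−1} (t²−1)^k` for `k ≥ 1`. -/
noncomputable def Mpoly : ℕ → ℝ → ℝ
  | 0, _ => 1
  | 1, t => t
  | (k + 2), t =>
      (1 / (2 ^ (k + 1) * (Nat.factorial (k + 1) : ℝ))) *
        iteratedDeriv k (fun x : ℝ => (x ^ 2 - 1) ^ (k + 1)) t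

/-- The 2D M-type coefficients `b_{i,j}` of a function `f` on `[−1,1]²`. -/
noncomputable def mcoeff2 (f : ℝ → ℝ → ℝ) : ℕ → ℕ → ℝ
  | 0, 0 => (f (-1) (-1) + f (-1) 1 + f 1 (-1) + f 1 1) / 4
  | 0, (j + 1) => ((2 * ((j : ℝ) + 1) - 1) / 4) *
      ∫ t in (-1:ℝ)..1, (deriv (f 1) t + deriv (f (-1)) t) * legendreP j t
  | (i + 1), 0 => ((2 * ((i : ℝ) + 1) - 1) / 4) *
      ∫ s in (-1:ℝ)..1,
        (deriv (fun x => f x 1) s + deriv (fun x => f x (-1)) s) * legendreP i s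
  | (i + 1), (j + 1) => ((2 * ((i : ℝ) + 1) - 1) * (2 * ((j : ℝ) + 1) - 1) / 4) *
      ∫ s in (-1:ℝ)..1, ∫ t in (-1:ℝ)..1,
        deriv (fun x => deriv (f x) t) s * legendreP i s * legendreP j t

/-- The `Q^k` M-type projection `f_{k,k}(s,t) = Σ_{i=0}^{k} Σ_{j=0}^{k} b_{i,j} M_i(s) M_j(t)`. -/
noncomputable def mproj2 (f : ℝ → ℝ → ℝ) (k : ℕ) (s t : ℝ) : ℝ :=
  ∑ i ∈ Finset.range (k + 1), ∑ j ∈ Finset.range (k + 1),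
    mcoeff2 f i j * Mpoly i s * Mpoly j t

/-- The mixed partial derivative `∂_s^i ∂_t^j f (s,t)`. -/
noncomputable def pderiv2 (i j : ℕ) (f : ℝ → ℝ → ℝ) (s t : ℝ) : ℝ :=
  iteratedDeriv i (fun x => iteratedDeriv j (f x) t) s

/-- The seminorm `[f]_m = ( ∬ (∂_s^m f)² + ∬ (∂_t^m f)² )^{1/2}` on `[−1,1]²`. -/
noncomputable def seminorm2 (m : ℕ) (f : ℝ → ℝ → ℝ) : ℝ :=
  Real.sqrt ((∫ s in (-1:ℝ)..1, ∫ t in (-1:ℝ)..1, (pderiv2 m 0 f s t) ^ 2) +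
             (∫ s in (-1:ℝ)..1, ∫ t in (-1:ℝ)..1, (pderiv2 0 m f s t) ^ 2))

section OneDimensional

open Polynomial

lemma iteratedDeriv_polynomial_eval (p : ℝ[X]) (n : ℕ) :
    iteratedDeriv n (fun x => p.eval x) = fun x => (derivative^[n] p).eval x := by
  induction n with
  | zero => simp
  | succ n ih =>
    rw [iteratedDeriv_succ, ih, Function.iterate_succ_apply']
    funext x
    exact Polynomial.deriv _

/-- The Legendre polynomial as an element of `ℝ[X]`. -/
noncomputable def legendrePoly (j : ℕ) : ℝ[X] :=
  C (1 / (2 ^ j * (Nat.factorial j : ℝ))) * derivative^[j] ((X ^ 2 - 1) ^ j)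

/-- The M-type polynomial as an element of `ℝ[X]`. -/
noncomputable def mTypePoly : ℕ → ℝ[X]
  | 0 => 1
  | 1 => X
  | (k + 2) => C (1 / (2 ^ (k + 1) * (Nat.factorial (k + 1) : ℝ))) *
      derivative^[k] ((X ^ 2 - 1) ^ (k + 1))

lemma eval_legendrePoly (j : ℕ) (t : ℝ) : (legendrePoly j).eval t = legendreP j t := by
  have h := congrFun (iteratedDeriv_polynomial_eval ((X ^ 2 - 1) ^ j) j) t
  simp only [eval_pow, eval_sub, eval_X, eval_one] at h
  rw [legendrePoly, legendreP, h, eval_mul, eval_C]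

lemma eval_mTypePoly (j : ℕ) (t : ℝ) : (mTypePoly j).eval t = Mpoly j t := by
  match j with
  | 0 => simp [mTypePoly, Mpoly]
  | 1 => simp [mTypePoly, Mpoly]
  | (k + 2) =>
    have h := congrFun (iteratedDeriv_polynomial_eval ((X ^ 2 - 1) ^ (k + 1)) k) t
    simp only [eval_pow, eval_sub, eval_X, eval_one] at h
    rw [mTypePoly, Mpoly, h, eval_mul, eval_C]

lemma derivative_mTypePoly_succ (j : ℕ) : derivative (mTypePoly (j + 1)) = legendrePoly j := by
  cases j with
  | zero => simp [mTypePoly, legendrePoly]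
  | succ k =>
    rw [mTypePoly, legendrePoly, derivative_C_mul, Function.iterate_succ_apply']

lemma natDegree_sq_sub_one_pow (n : ℕ) : ((X ^ 2 - 1 : ℝ[X]) ^ n).natDegree = 2 * n := by
  have h : (X ^ 2 - 1 : ℝ[X]).natDegree = 2 := by
    simpa using natDegree_X_pow_sub_C (n := 2) (r := (1 : ℝ))
  rw [natDegree_pow, h, mul_comm]

lemma monic_sq_sub_one_pow (n : ℕ) : ((X ^ 2 - 1 : ℝ[X]) ^ n).Monic := by
  have h : (X ^ 2 - 1 : ℝ[X]).Monic := by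
    simpa using monic_X_pow_sub_C (1 : ℝ) (two_ne_zero)
  exact h.pow n

lemma degree_legendrePoly (j : ℕ) : (legendrePoly j).degree = j := by
  have hc : (1 / (2 ^ j * (Nat.factorial j : ℝ))) ≠ 0 := by positivity
  apply degree_eq_of_le_of_coeff_ne_zero
  · apply degree_le_of_natDegree_le
    rw [legendrePoly]
    refine (natDegree_C_mul_le _ _).trans ((natDegree_iterate_derivative _ _).trans ?_)
    rw [natDegree_sq_sub_one_pow]; omega
  · rw [legendrePoly, coeff_C_mul, coeff_iterate_derivative]
    have h : ((X ^ 2 - 1 : ℝ[X]) ^ j).coeff (j + j) = 1 := by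
      have := monic_sq_sub_one_pow j
      rwa [Monic, leadingCoeff, natDegree_sq_sub_one_pow, two_mul] at this
    rw [h]
    refine mul_ne_zero hc ?_
    rw [nsmul_eq_mul, mul_one, Nat.cast_ne_zero]
    exact (Nat.descFactorial_pos.2 (by omega)).ne'

lemma natDegree_legendrePoly (j : ℕ) : (legendrePoly j).natDegree = j :=
  natDegree_eq_of_degree_eq_some (degree_legendrePoly j)

lemma degree_mTypePoly (j : ℕ) : (mTypePoly j).degree = j := by
  cases j with
  | zero => simp [mTypePoly]
  | succ j =>
    have h := natDegree_derivative (mTypePoly (j + 1))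
    rw [derivative_mTypePoly_succ, natDegree_legendrePoly] at h
    have hne : mTypePoly (j + 1) ≠ 0 := by
      intro h0
      have h1 := derivative_mTypePoly_succ j
      rw [h0, derivative_zero] at h1
      have := degree_legendrePoly j
      rw [← h1, degree_zero] at this
      exact absurd this (by simp)
    have hpos : (mTypePoly (j + 1)).natDegree ≠ 0 := by
      intro h0
      have h1 := derivative_of_natDegree_zero h0
      rw [derivative_mTypePoly_succ] at h1
      have := degree_legendrePoly j
      rw [h1, degree_zero] at this
      exact absurd this (by simp)
    rw [degree_eq_natDegree hne]
    norm_cast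
    omega

/-- The Legendre polynomials as a polynomial sequence. -/
noncomputable def legendreSeq : Polynomial.Sequence ℝ where
  elems' := legendrePoly
  degree_eq' := degree_legendrePoly

/-- The M-type polynomials as a polynomial sequence. -/
noncomputable def mTypeSeq : Polynomial.Sequence ℝ where
  elems' := mTypePoly
  degree_eq' := degree_mTypePoly

lemma sequence_induction (S : Polynomial.Sequence ℝ) (n : ℕ) {P : ℝ[X] → Prop}
    (hmem : ∀ i < n, P (S i)) (h0 : P 0) (hadd : ∀ p q, P p → P q → P (p + q))
    (hsmul : ∀ (c : ℝ) p, P p → P (c • p)) {p : ℝ[X]} (hp : p.degree < n) : P p := by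
  have h : p ∈ Submodule.span ℝ (S '' Set.Iio n) := by
    rw [Sequence.span_degreeLT _ (fun i _ => (leadingCoeff_ne_zero.2 (S.ne_zero i)).isUnit)]
    exact mem_degreeLT.2 hp
  clear hp
  induction h using Submodule.span_induction with
  | mem x hx => obtain ⟨i, hi, rfl⟩ := hx; exact hmem i hi
  | zero => exact h0
  | add x y _ _ hx hy => exact hadd x y hx hy
  | smul c x _ hx => exact hsmul c x hx

lemma integral_eval_mul_eval_derivative (p q : ℝ[X]) :
    ∫ x in (-1:ℝ)..1, p.eval x * (derivative q).eval x =
      p.eval 1 * q.eval 1 - p.eval (-1) * q.eval (-1) -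
        ∫ x in (-1:ℝ)..1, (derivative p).eval x * q.eval x :=
  integral_mul_deriv_eq_deriv_mul (fun x _ => p.hasDerivAt x) (fun x _ => q.hasDerivAt x)
    ((derivative p).continuous.intervalIntegrable _ _)
    ((derivative q).continuous.intervalIntegrable _ _)

lemma eval_iterate_derivative_sq_sub_one_pow {n m : ℕ} (h : m < n) {x : ℝ} (hx : x ^ 2 = 1) :
    (derivative^[m] ((X ^ 2 - 1 : ℝ[X]) ^ n)).eval x = 0 := by
  obtain ⟨r, hr⟩ := pow_sub_dvd_iterate_derivative_pow (X ^ 2 - 1 : ℝ[X]) n m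
  rw [hr, eval_mul, eval_pow]
  simp [hx, Nat.sub_ne_zero_of_lt h]

lemma integral_iterate_derivative_sq_sub_one_pow_mul (n : ℕ) (q : ℝ[X]) {m : ℕ} (hm : m ≤ n) :
    ∫ x in (-1:ℝ)..1, q.eval x * (derivative^[m] ((X ^ 2 - 1 : ℝ[X]) ^ n)).eval x =
      (-1) ^ m * ∫ x in (-1:ℝ)..1, (derivative^[m] q).eval x * (x ^ 2 - 1) ^ n := by
  induction m generalizing q with
  | zero => simp
  | succ m ih =>
    rw [Function.iterate_succ_apply', integral_eval_mul_eval_derivative,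
      eval_iterate_derivative_sq_sub_one_pow hm (by norm_num),
      eval_iterate_derivative_sq_sub_one_pow hm (by norm_num), ih _ (by omega),
      ← Function.iterate_succ_apply]
    ring

lemma integral_sq_sub_one_pow_succ (n : ℕ) :
    (2 * (n : ℝ) + 3) * ∫ x in (-1:ℝ)..1, (x ^ 2 - 1) ^ (n + 1) =
      -(2 * (n : ℝ) + 2) * ∫ x in (-1:ℝ)..1, (x ^ 2 - 1) ^ n := by
  have h := integral_eval_mul_eval_derivative ((X ^ 2 - 1) ^ (n + 1)) X
  simp only [derivative_pow, derivative_sub, derivative_one, derivative_X, eval_pow, eval_sub,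
    eval_X, eval_one, eval_mul, map_natCast, eval_natCast, sub_zero] at h
  have h2 : ∀ x : ℝ, ((n + 1 : ℕ) : ℝ) * (x ^ 2 - 1) ^ (n + 1 - 1) * ((2 : ℕ) * x ^ (2 - 1) * 1) * x
      = (2 * n + 2) * (x ^ 2 - 1) ^ (n + 1) + (2 * n + 2) * (x ^ 2 - 1) ^ n := by
    intro x
    simp only [Nat.add_sub_cancel]
    push_cast
    ring
  rw [show (1 : ℝ) ^ 2 - 1 = 0 by norm_num, show (-1 : ℝ) ^ 2 - 1 = 0 by norm_num] at h
  simp only [h2] at h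
  rw [intervalIntegral.integral_add (by apply Continuous.intervalIntegrable; fun_prop)
    (by apply Continuous.intervalIntegrable; fun_prop), intervalIntegral.integral_const_mul,
    intervalIntegral.integral_const_mul] at h
  simp only [mul_one, ne_eq, Nat.add_eq_zero_iff, one_ne_zero, and_false, not_false_eq_true,
    zero_pow, zero_mul, sub_zero] at h
  linarith

lemma integral_sq_sub_one_pow (n : ℕ) :
    (2 * (n : ℝ) + 1) * (Nat.factorial (2 * n) : ℝ) * ∫ x in (-1:ℝ)..1, (x ^ 2 - 1) ^ n =
      2 * (-1) ^ n * (2 ^ n * (Nat.factorial n : ℝ)) ^ 2 := by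
  induction n with
  | zero => simp; norm_num
  | succ n ih =>
    have h := integral_sq_sub_one_pow_succ n
    rw [show 2 * (n + 1) = 2 * n + 1 + 1 by ring, Nat.factorial_succ, Nat.factorial_succ,
      Nat.factorial_succ n]
    push_cast
    set I := ∫ x in (-1:ℝ)..1, (x ^ 2 - 1) ^ (n + 1)
    set J := ∫ x in (-1:ℝ)..1, (x ^ 2 - 1) ^ n
    linear_combination (2 * (n : ℝ) + 2) * (2 * n + 1) * (Nat.factorial (2 * n) : ℝ) * h
      - (2 * (n : ℝ) + 2) ^ 2 * ih

lemma integral_legendrePoly_mul_eq_zero {p : ℝ[X]} {n : ℕ} (hp : p.degree < n) :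
    ∫ x in (-1:ℝ)..1, p.eval x * (legendrePoly n).eval x = 0 := by
  simp only [legendrePoly, eval_mul, eval_C, mul_left_comm]
  rw [intervalIntegral.integral_const_mul, integral_iterate_derivative_sq_sub_one_pow_mul _ _ le_rfl,
    iterate_derivative_eq_zero_of_degree_lt hp]
  simp

lemma integral_legendrePoly_sq (n : ℕ) :
    ∫ x in (-1:ℝ)..1, (legendrePoly n).eval x * (legendrePoly n).eval x = 2 / (2 * n + 1) := by
  have h0 : derivative^[n] (legendrePoly n) =
      C (1 / (2 ^ n * (Nat.factorial n : ℝ)) * Nat.factorial (2 * n)) := by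
    rw [legendrePoly, iterate_derivative_C_mul, ← Function.iterate_add_apply, C_mul]
    congr 1
    ext i
    rw [coeff_iterate_derivative, coeff_C]
    have hd := natDegree_sq_sub_one_pow n
    split_ifs with hi
    · subst hi
      have := monic_sq_sub_one_pow n
      rw [Monic, leadingCoeff, hd, two_mul] at this
      rw [zero_add, this, Nat.descFactorial_self, two_mul]; simp
    · rw [coeff_eq_zero_of_natDegree_lt (by omega), smul_zero]
  have h1 : ∀ x, (legendrePoly n).eval x = 1 / (2 ^ n * (Nat.factorial n : ℝ)) *
      (derivative^[n] ((X ^ 2 - 1 : ℝ[X]) ^ n)).eval x := fun x => by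
    rw [legendrePoly, eval_mul, eval_C]
  have h2 : ∀ x, (legendrePoly n).eval x * (legendrePoly n).eval x =
      1 / (2 ^ n * (Nat.factorial n : ℝ)) * ((legendrePoly n).eval x *
      (derivative^[n] ((X ^ 2 - 1 : ℝ[X]) ^ n)).eval x) := fun x => by
    nth_rewrite 2 [h1]; ring
  simp only [h2]
  rw [intervalIntegral.integral_const_mul, integral_iterate_derivative_sq_sub_one_pow_mul _ _ le_rfl,
    h0]
  simp only [eval_C]
  rw [intervalIntegral.integral_const_mul]
  have h := integral_sq_sub_one_pow n
  have hs : ((-1 : ℝ) ^ n) * (-1) ^ n = 1 := by rw [← mul_pow]; simp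
  have hf : (2 ^ n * (Nat.factorial n : ℝ)) ≠ 0 := by positivity
  have hn : (2 * (n : ℝ) + 1) ≠ 0 := by positivity
  field_simp
  field_simp at h
  linear_combination ((-1 : ℝ) ^ n) * h + 2 * (2 ^ n * (Nat.factorial n : ℝ)) ^ 2 * hs

lemma integral_legendrePoly_mul (i j : ℕ) :
    ∫ x in (-1:ℝ)..1, (legendrePoly i).eval x * (legendrePoly j).eval x =
      if i = j then 2 / (2 * (i : ℝ) + 1) else 0 := by
  split_ifs with h
  · subst h; exact integral_legendrePoly_sq i
  · rcases lt_or_gt_of_ne h with h | h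
    · exact integral_legendrePoly_mul_eq_zero (by rw [degree_legendrePoly]; exact_mod_cast h)
    · simp only [mul_comm ((legendrePoly i).eval _)]
      exact integral_legendrePoly_mul_eq_zero (by rw [degree_legendrePoly]; exact_mod_cast h)

/-- The reproducing kernel `∑_{j<m} (2j+1)/2 l_j(s) l_j(x)` of the polynomials of degree `< m`
on `[-1,1]`. -/
noncomputable def legendreKernel (m : ℕ) (s x : ℝ) : ℝ :=
  ∑ j ∈ Finset.range m, (2 * (j : ℝ) + 1) / 2 * (legendrePoly j).eval s * (legendrePoly j).eval x

lemma continuous_legendreKernel (m : ℕ) : Continuous (Function.uncurry (legendreKernel m)) := by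
  unfold legendreKernel Function.uncurry
  fun_prop

lemma integral_legendreKernel_mul {m : ℕ} {p : ℝ[X]} (hp : p.degree < m) (s : ℝ) :
    ∫ x in (-1:ℝ)..1, legendreKernel m s x * p.eval x = p.eval s := by
  have hc : Continuous (legendreKernel m s) :=
    (continuous_legendreKernel m).comp (Continuous.prodMk_right s)
  refine sequence_induction legendreSeq m
    (P := fun p => ∫ x in (-1:ℝ)..1, legendreKernel m s x * p.eval x = p.eval s)
    ?_ (by simp) ?_ ?_ hp
  · intro i hi
    change ∫ x in (-1:ℝ)..1, legendreKernel m s x * (legendrePoly i).eval x = _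
    simp only [legendreKernel, Finset.sum_mul]
    rw [intervalIntegral.integral_finsetSum
      (fun j _ => by apply Continuous.intervalIntegrable; fun_prop)]
    simp only [mul_assoc ((2 * ((_ : ℕ) : ℝ) + 1) / 2 * _), intervalIntegral.integral_const_mul,
      integral_legendrePoly_mul, mul_ite, mul_zero]
    rw [Finset.sum_ite_eq' , if_pos (Finset.mem_range.2 hi)]
    change _ = (legendrePoly i).eval s
    field_simp
  · intro p q hp hq
    simp only [eval_add, mul_add]
    rw [intervalIntegral.integral_add (by apply Continuous.intervalIntegrable; fun_prop)
      (by apply Continuous.intervalIntegrable; fun_prop), hp, hq]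
  · intro c p hp
    simp only [eval_smul, smul_eq_mul, mul_left_comm _ c]
    rw [intervalIntegral.integral_const_mul, hp]

lemma eval_mTypePoly_add_two (j : ℕ) {x : ℝ} (hx : x ^ 2 = 1) :
    (mTypePoly (j + 2)).eval x = 0 := by
  rw [mTypePoly, eval_mul, eval_iterate_derivative_sq_sub_one_pow (by omega) hx, mul_zero]

lemma abs_le_one_of_Mpoly_eq_zero {k : ℕ} {s : ℝ} (h : Mpoly (k + 2) s = 0) : |s| ≤ 1 := by
  rw [← eval_mTypePoly, mTypePoly, eval_mul, eval_C] at h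
  replace h := (mul_eq_zero.1 h).resolve_left (by positivity)
  set P : ℂ[X] := (X ^ 2 - 1) ^ (k + 1)
  have hmap : ((X ^ 2 - 1 : ℝ[X]) ^ (k + 1)).map (algebraMap ℝ ℂ) = P := by
    simp [P]
  have hP : P.natDegree = 2 * (k + 1) := by
    rw [← hmap, natDegree_map, natDegree_sq_sub_one_pow]
  have hroots : ∀ m ≤ k, (derivative^[m] P).rootSet ℂ ⊆ convexHull ℝ {(-1 : ℂ), 1} := by
    intro m
    induction m with
    | zero =>
      intro _ z hz
      apply subset_convexHull
      have : z ^ 2 - 1 = 0 := by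
        have := (mem_rootSet.1 hz).2
        simpa [P] using this
      have : (z - 1) * (z + 1) = 0 := by linear_combination this
      rcases mul_eq_zero.1 this with h | h
      · right; exact sub_eq_zero.1 h
      · left; exact eq_neg_of_add_eq_zero_left h
    | succ m ih =>
      intro hm
      rw [Function.iterate_succ_apply']
      refine (rootSet_derivative_subset_convexHull_rootSet ?_).trans
        (convexHull_min (ih (by omega)) (convex_convexHull _ _))
      rw [← natDegree_pos_iff_degree_pos]
      by_contra h0
      have h1 : derivative^[2 * (k + 1) - m] (derivative^[m] P) = 0 :=
        iterate_derivative_eq_zero (by omega)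
      rw [← Function.iterate_add_apply, show 2 * (k + 1) - m + m = 2 * (k + 1) by omega] at h1
      have h2 := congrArg (fun q => q.coeff 0) h1
      simp only [coeff_iterate_derivative, zero_add, coeff_zero] at h2
      rw [← hP, coeff_natDegree, Nat.descFactorial_self, ← hmap,
        ((monic_sq_sub_one_pow _).map _).leadingCoeff] at h2
      simp [Nat.factorial_ne_zero] at h2
  have hne : derivative^[k] P ≠ 0 := by
    intro h1
    have h2 := congrArg (fun q => q.coeff (2 * (k + 1) - k)) h1
    simp only [coeff_iterate_derivative, coeff_zero] at h2
    rw [show 2 * (k + 1) - k + k = 2 * (k + 1) by omega, ← hP, coeff_natDegree, ← hmap,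
        ((monic_sq_sub_one_pow _).map _).leadingCoeff, natDegree_map,
        natDegree_sq_sub_one_pow] at h2
    simp [Nat.descFactorial_eq_zero_iff_lt] at h2
    omega
  have hs : (s : ℂ) ∈ (derivative^[k] P).rootSet ℂ := by
    refine mem_rootSet.2 ⟨hne, ?_⟩
    rw [← hmap, iterate_derivative_map]
    rw [aeval_map_algebraMap]
    have := aeval_algebraMap_apply ℂ s (derivative^[k] ((X ^ 2 - 1 : ℝ[X]) ^ (k + 1)))
    rw [coe_aeval_eq_eval, h, map_zero] at this
    exact this
  have hball : convexHull ℝ {(-1 : ℂ), 1} ⊆ Metric.closedBall 0 1 := by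
    refine convexHull_min ?_ (convex_closedBall _ _)
    rintro z (rfl | rfl) <;> simp
  simpa using hball (hroots k le_rfl hs)

end OneDimensional
section Coefficients

open Polynomial

lemma continuous_Mpoly (j : ℕ) : Continuous (Mpoly j) := by
  rw [show Mpoly j = fun t => (mTypePoly j).eval t from
    funext fun t => (eval_mTypePoly j t).symm]
  fun_prop

/-- The one-dimensional M-type coefficient functional, with the derivative of the function
moved to the Legendre polynomial by integration by parts. -/
noncomputable def mCoeff1 : ℕ → (ℝ → ℝ) → ℝ
  | 0, g => (g 1 + g (-1)) / 2
  | (i + 1), g => (2 * ((i : ℝ) + 1) - 1) / 2 *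
      (g 1 * (legendrePoly i).eval 1 - g (-1) * (legendrePoly i).eval (-1) -
        ∫ x in (-1:ℝ)..1, g x * (derivative (legendrePoly i)).eval x)

lemma integral_hasDerivAt_mul_legendrePoly {g g' : ℝ → ℝ} (h : ∀ x, HasDerivAt g (g' x) x)
    (hg' : Continuous g') (i : ℕ) :
    ∫ x in (-1:ℝ)..1, g' x * (legendrePoly i).eval x =
      g 1 * (legendrePoly i).eval 1 - g (-1) * (legendrePoly i).eval (-1) -
        ∫ x in (-1:ℝ)..1, g x * (derivative (legendrePoly i)).eval x := by
  have := integral_mul_deriv_eq_deriv_mul (a := -1) (b := 1)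
    (fun x _ => h x) (fun x _ => (legendrePoly i).hasDerivAt x)
    (hg'.intervalIntegrable _ _) ((derivative (legendrePoly i)).continuous.intervalIntegrable _ _)
  rw [this]; ring

lemma mCoeff1_succ_eq {g g' : ℝ → ℝ} (h : ∀ x, HasDerivAt g (g' x) x) (hg' : Continuous g')
    (i : ℕ) : mCoeff1 (i + 1) g =
      (2 * ((i : ℝ) + 1) - 1) / 2 * ∫ x in (-1:ℝ)..1, g' x * (legendrePoly i).eval x := by
  rw [mCoeff1, integral_hasDerivAt_mul_legendrePoly h hg']

lemma mCoeff1_add (i : ℕ) {g h : ℝ → ℝ} (hg : Continuous g) (hh : Continuous h) :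
    mCoeff1 i (fun x => g x + h x) = mCoeff1 i g + mCoeff1 i h := by
  cases i with
  | zero => simp only [mCoeff1]; ring
  | succ i =>
    simp only [mCoeff1, add_mul]
    rw [intervalIntegral.integral_add (by apply Continuous.intervalIntegrable; fun_prop)
      (by apply Continuous.intervalIntegrable; fun_prop)]
    ring

lemma mCoeff1_const_mul (i : ℕ) (c : ℝ) (g : ℝ → ℝ) :
    mCoeff1 i (fun x => c * g x) = c * mCoeff1 i g := by
  cases i with
  | zero => simp only [mCoeff1]; ring
  | succ i =>
    simp only [mCoeff1, mul_assoc c, intervalIntegral.integral_const_mul]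
    ring

lemma mCoeff1_sum (i : ℕ) {ι : Type*} (S : Finset ι) {g : ι → ℝ → ℝ}
    (hg : ∀ a, Continuous (g a)) :
    mCoeff1 i (fun x => ∑ a ∈ S, g a x) = ∑ a ∈ S, mCoeff1 i (g a) := by
  classical
  induction S using Finset.induction_on with
  | empty => simpa using mCoeff1_const_mul i 0 (fun _ => 0)
  | insert a S ha ih =>
    simp only [Finset.sum_insert ha]
    rw [mCoeff1_add i (hg a) (continuous_finsetSum _ fun b _ => hg b), ih]

lemma continuous_mCoeff1 (i : ℕ) {f : ℝ → ℝ → ℝ} (hf : Continuous (Function.uncurry f)) :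
    Continuous (fun s => mCoeff1 i (f s)) := by
  have h1 : ∀ t, Continuous (fun s => f s t) := fun t => hf.comp (Continuous.prodMk_left t)
  cases i with
  | zero => exact ((h1 1).add (h1 (-1))).div_const 2
  | succ i =>
    simp only [mCoeff1]
    refine continuous_const.mul ((((h1 1).mul continuous_const).sub
      ((h1 (-1)).mul continuous_const)).sub ?_)
    apply intervalIntegral.continuous_parametric_intervalIntegral_of_continuous'
    exact hf.mul (by fun_prop)

lemma exists_bound_mCoeff1 (i : ℕ) : ∃ K, 0 ≤ K ∧ ∀ (g : ℝ → ℝ) (A : ℝ),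
    (∀ x ∈ Set.Icc (-1:ℝ) 1, |g x| ≤ A) → |mCoeff1 i g| ≤ K * A := by
  cases i with
  | zero =>
    refine ⟨1, zero_le_one, fun g A h => ?_⟩
    have h1 := h 1 (by norm_num)
    have h2 := h (-1) (by norm_num)
    rw [abs_le] at *
    simp only [mCoeff1]
    constructor <;> linarith
  | succ i =>
    obtain ⟨D, hD⟩ := (isCompact_Icc (a := (-1:ℝ)) (b := 1)).exists_bound_of_continuousOn
      (derivative (legendrePoly i)).continuous.continuousOn
    have hD0 : 0 ≤ D := (norm_nonneg _).trans (hD 1 (by norm_num))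
    refine ⟨(2 * ((i : ℝ) + 1) - 1) / 2 * (|(legendrePoly i).eval 1| +
      |(legendrePoly i).eval (-1)| + 2 * D), ?_, fun g A h => ?_⟩
    · have : 0 ≤ (2 * ((i : ℝ) + 1) - 1) / 2 := by
        have : (0 : ℝ) ≤ i := Nat.cast_nonneg i
        linarith
      positivity
    · have h0 : 0 ≤ (2 * ((i : ℝ) + 1) - 1) / 2 := by
        have : (0 : ℝ) ≤ i := Nat.cast_nonneg i
        linarith
      have hA : 0 ≤ A := (abs_nonneg _).trans (h 1 (by norm_num))
      have hbound : |∫ x in (-1:ℝ)..1, g x * (derivative (legendrePoly i)).eval x| ≤ A * D * 2 := by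
        have := intervalIntegral.norm_integral_le_of_norm_le_const (a := (-1:ℝ)) (b := 1)
          (f := fun x => g x * (derivative (legendrePoly i)).eval x) (C := A * D) (fun x hx => by
            rw [Set.uIoc_of_le (by norm_num)] at hx
            have hx' : x ∈ Set.Icc (-1:ℝ) 1 := ⟨hx.1.le, hx.2⟩
            rw [norm_mul]
            exact mul_le_mul (h x hx') (hD x hx') (norm_nonneg _) hA)
        norm_num at this
        exact this
      rw [mCoeff1, abs_mul, abs_of_nonneg h0, mul_assoc]
      refine mul_le_mul_of_nonneg_left ?_ h0
      have e1 : |g 1 * (legendrePoly i).eval 1| ≤ A * |(legendrePoly i).eval 1| := by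
        rw [abs_mul]; gcongr; exact h 1 (by norm_num)
      have e2 : |g (-1) * (legendrePoly i).eval (-1)| ≤ A * |(legendrePoly i).eval (-1)| := by
        rw [abs_mul]; gcongr; exact h (-1) (by norm_num)
      refine (abs_sub _ _).trans ((add_le_add_left (abs_sub _ _) _).trans ?_)
      linarith

lemma mCoeff1_mTypePoly (i j : ℕ) :
    mCoeff1 i (fun x => (mTypePoly j).eval x) = if i = j then 1 else 0 := by
  cases i with
  | zero =>
    match j with
    | 0 => simp [mCoeff1, mTypePoly]
    | 1 => simp [mCoeff1, mTypePoly]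
    | (j + 2) =>
      simp [mCoeff1, eval_mTypePoly_add_two j (show (1:ℝ) ^ 2 = 1 by norm_num),
        eval_mTypePoly_add_two j (show (-1:ℝ) ^ 2 = 1 by norm_num)]
  | succ i =>
    rw [mCoeff1_succ_eq (fun x => (mTypePoly j).hasDerivAt x) (by fun_prop)]
    cases j with
    | zero => simp [mTypePoly]
    | succ j =>
      rw [derivative_mTypePoly_succ, integral_legendrePoly_mul]
      by_cases h : i = j
      · subst h
        have : (2 * (i : ℝ) + 1) ≠ 0 := by positivity
        simp only [if_true]
        field_simp
        ring
      · simp [h, Ne.symm h]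

/-- One-dimensional projection: it reproduces polynomials of degree at most `k`, and those of
degree `k + 1` at the Lobatto points. -/
lemma sum_mCoeff1_mul_Mpoly {p : ℝ[X]} {k : ℕ} (hp : p.degree < (k + 2 : ℕ)) {s : ℝ}
    (hs : Mpoly (k + 1) s = 0) :
    ∑ i ∈ Finset.range (k + 1), mCoeff1 i (fun x => p.eval x) * Mpoly i s = p.eval s := by
  refine sequence_induction mTypeSeq (k + 2)
    (P := fun p => ∑ i ∈ Finset.range (k + 1), mCoeff1 i (fun x => p.eval x) * Mpoly i s =
      p.eval s) ?_ ?_ ?_ ?_ hp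
  · intro j hj
    change ∑ i ∈ Finset.range (k + 1), mCoeff1 i (fun x => (mTypePoly j).eval x) * Mpoly i s =
      (mTypePoly j).eval s
    simp only [mCoeff1_mTypePoly, ite_mul, one_mul, zero_mul, Finset.sum_ite_eq',
      Finset.mem_range]
    rw [eval_mTypePoly]
    split_ifs with h
    · rfl
    · rw [show j = k + 1 by omega, hs]
  · have h : ∀ i, mCoeff1 i (fun _ => 0) = 0 := fun i => by
      simpa using mCoeff1_const_mul i 0 (fun _ => 0)
    simp [h]
  · intro p q hp hq
    simp only [eval_add]
    simp only [mCoeff1_add _ p.continuous q.continuous, add_mul, Finset.sum_add_distrib, hp, hq]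
  · intro c p hp
    simp only [eval_smul, smul_eq_mul, mCoeff1_const_mul, mul_assoc, ← Finset.mul_sum, hp]

end Coefficients
section TwoDimensional

open Polynomial MeasureTheory

lemma intervalIntegral_swap {F : ℝ → ℝ → ℝ} (hF : Continuous (Function.uncurry F))
    (a b c d : ℝ) :
    ∫ x in a..b, ∫ y in c..d, F x y = ∫ y in c..d, ∫ x in a..b, F x y := by
  apply intervalIntegral_intervalIntegral_swap
  exact (hF.continuousOn.integrableOn_compact
    (isCompact_uIcc.prod isCompact_uIcc)).mono_set
      (Set.prod_mono Set.uIoc_subset_uIcc Set.uIoc_subset_uIcc)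

variable {f : ℝ → ℝ → ℝ}

lemma contDiff_flip (hf : ContDiff ℝ (⊤ : ℕ∞) (Function.uncurry f)) :
    ContDiff ℝ (⊤ : ℕ∞) (Function.uncurry (flip f)) :=
  hf.comp (contDiff_snd.prodMk contDiff_fst)

lemma contDiff_left (hf : ContDiff ℝ (⊤ : ℕ∞) (Function.uncurry f)) (t : ℝ) :
    ContDiff ℝ (⊤ : ℕ∞) (fun x => f x t) :=
  hf.comp (contDiff_id.prodMk contDiff_const)

lemma contDiff_right (hf : ContDiff ℝ (⊤ : ℕ∞) (Function.uncurry f)) (s : ℝ) :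
    ContDiff ℝ (⊤ : ℕ∞) (f s) :=
  hf.comp (contDiff_const.prodMk contDiff_id)

lemma hasDerivAt_left (hf : ContDiff ℝ (⊤ : ℕ∞) (Function.uncurry f)) (s t : ℝ) :
    HasDerivAt (fun x => f x t) (deriv (fun x => f x t) s) s :=
  ((contDiff_left hf t).differentiable (by simp) s).hasDerivAt

lemma hasDerivAt_right (hf : ContDiff ℝ (⊤ : ℕ∞) (Function.uncurry f)) (s t : ℝ) :
    HasDerivAt (f s) (deriv (f s) t) t :=
  ((contDiff_right hf s).differentiable (by simp) t).hasDerivAt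

lemma deriv_left_eq_fderiv (hf : ContDiff ℝ (⊤ : ℕ∞) (Function.uncurry f)) (s t : ℝ) :
    deriv (fun x => f x t) s = fderiv ℝ (Function.uncurry f) (s, t) (1, 0) := by
  have h := (hf.differentiable (by simp) (s, t)).hasFDerivAt
  exact (h.comp_hasDerivAt s ((hasDerivAt_id s).prodMk (hasDerivAt_const s t))).deriv

lemma deriv_right_eq_fderiv (hf : ContDiff ℝ (⊤ : ℕ∞) (Function.uncurry f)) (s t : ℝ) :
    deriv (f s) t = fderiv ℝ (Function.uncurry f) (s, t) (0, 1) := by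
  have h := (hf.differentiable (by simp) (s, t)).hasFDerivAt
  exact (h.comp_hasDerivAt t ((hasDerivAt_const t s).prodMk (hasDerivAt_id t))).deriv

lemma contDiff_deriv_left (hf : ContDiff ℝ (⊤ : ℕ∞) (Function.uncurry f)) :
    ContDiff ℝ (⊤ : ℕ∞) (Function.uncurry fun s t => deriv (fun x => f x t) s) := by
  have h : (Function.uncurry fun s t => deriv (fun x => f x t) s) =
      fun p => fderiv ℝ (Function.uncurry f) p (1, 0) :=
    funext fun p => deriv_left_eq_fderiv hf p.1 p.2
  rw [h]
  exact (hf.fderiv_right (by simp)).clm_apply contDiff_const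

lemma contDiff_deriv_right (hf : ContDiff ℝ (⊤ : ℕ∞) (Function.uncurry f)) :
    ContDiff ℝ (⊤ : ℕ∞) (Function.uncurry fun s t => deriv (f s) t) :=
  contDiff_flip (contDiff_deriv_left (contDiff_flip hf))

lemma contDiff_iteratedDeriv_left (hf : ContDiff ℝ (⊤ : ℕ∞) (Function.uncurry f)) (n : ℕ) :
    ContDiff ℝ (⊤ : ℕ∞) (Function.uncurry fun s t => iteratedDeriv n (fun x => f x t) s) := by
  induction n with
  | zero => simpa using hf
  | succ n ih =>
    simp only [iteratedDeriv_succ]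
    exact contDiff_deriv_left ih

lemma mcoeff2_eq_mCoeff1_mCoeff1 (hf : ContDiff ℝ (⊤ : ℕ∞) (Function.uncurry f)) (i j : ℕ) :
    mcoeff2 f i j = mCoeff1 i (fun s => mCoeff1 j (f s)) := by
  have hR := contDiff_deriv_right hf
  match i, j with
  | 0, 0 => simp only [mcoeff2, mCoeff1]; ring
  | 0, (j + 1) =>
    have h : ∀ s, Continuous (deriv (f s)) := fun s => (contDiff_right hR s).continuous
    rw [mcoeff2]
    simp only [← eval_legendrePoly, add_mul]
    rw [intervalIntegral.integral_add
      (by have := h 1; apply Continuous.intervalIntegrable; fun_prop)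
      (by have := h (-1); apply Continuous.intervalIntegrable; fun_prop), mCoeff1,
      mCoeff1_succ_eq (hasDerivAt_right hf 1) (h 1),
      mCoeff1_succ_eq (hasDerivAt_right hf (-1)) (h (-1))]
    ring
  | (i + 1), 0 =>
    have h : ∀ t, Continuous (deriv (fun x => f x t)) := fun t =>
      (contDiff_left (contDiff_deriv_left hf) t).continuous
    simp only [mCoeff1.eq_1]
    have hd : ∀ s, HasDerivAt (fun s => (f s 1 + f s (-1)) / 2)
        ((deriv (fun x => f x 1) s + deriv (fun x => f x (-1)) s) / 2) s := fun s =>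
      ((hasDerivAt_left hf s 1).add (hasDerivAt_left hf s (-1))).div_const 2
    rw [mCoeff1_succ_eq hd
      (by have := h 1; have := h (-1); fun_prop), mcoeff2]
    simp only [← eval_legendrePoly, div_mul_eq_mul_div, intervalIntegral.integral_div]
    ring
  | (i + 1), (j + 1) =>
    have hRc : Continuous (fun p : ℝ × ℝ => deriv (f p.1) p.2) := hR.continuous
    have hLR : Continuous (fun p : ℝ × ℝ => deriv (fun x => deriv (f x) p.2) p.1) :=
      (contDiff_deriv_left hR).continuous
    have hLR' : ∀ t, Continuous (fun s => deriv (fun x => deriv (f x) t) s) := fun t =>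
      hLR.comp (Continuous.prodMk_left t)
    have h : ∀ s, Continuous (deriv (f s)) := fun s => (contDiff_right hR s).continuous
    have e1 : ∀ s, mCoeff1 (j + 1) (f s) = (2 * ((j : ℝ) + 1) - 1) / 2 *
        ∫ t in (-1:ℝ)..1, deriv (f s) t * (legendrePoly j).eval t := fun s =>
      mCoeff1_succ_eq (hasDerivAt_right hf s) (h s) j
    simp only [e1, mCoeff1_const_mul]
    have e2 : ∫ s in (-1:ℝ)..1, ∫ t in (-1:ℝ)..1, deriv (fun x => deriv (f x) t) s *
        (legendrePoly i).eval s * (legendrePoly j).eval t =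
        (∫ t in (-1:ℝ)..1, deriv (f 1) t * (legendrePoly j).eval t) * (legendrePoly i).eval 1 -
        (∫ t in (-1:ℝ)..1, deriv (f (-1)) t * (legendrePoly j).eval t) *
          (legendrePoly i).eval (-1) -
        ∫ s in (-1:ℝ)..1, (∫ t in (-1:ℝ)..1, deriv (f s) t * (legendrePoly j).eval t) *
          (derivative (legendrePoly i)).eval s := by
      rw [intervalIntegral_swap (by unfold Function.uncurry; fun_prop)]
      simp only [intervalIntegral.integral_mul_const]
      simp only [integral_hasDerivAt_mul_legendrePoly (fun s => hasDerivAt_left hR s _) (hLR' _)]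
      simp only [← intervalIntegral.integral_mul_const]
      rw [intervalIntegral_swap (F := fun s t => _) (by unfold Function.uncurry; fun_prop)]
      have hc : Continuous fun t => ∫ s in (-1:ℝ)..1,
          deriv (f s) t * (derivative (legendrePoly i)).eval s := by
        apply intervalIntegral.continuous_parametric_intervalIntegral_of_continuous'
        have : Continuous (fun p : ℝ × ℝ => deriv (f p.2) p.1) := hRc.comp continuous_swap
        unfold Function.uncurry
        fun_prop
      have h1 := h 1
      have h2 := h (-1)
      rw [← intervalIntegral.integral_sub (by apply Continuous.intervalIntegrable; fun_prop)
        (by apply Continuous.intervalIntegrable; fun_prop)]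
      simp only [mul_right_comm _ (eval _ (legendrePoly j)) (eval _ (derivative _)),
        intervalIntegral.integral_mul_const]
      rw [← intervalIntegral.integral_sub (by apply Continuous.intervalIntegrable; fun_prop)
        (by apply Continuous.intervalIntegrable; fun_prop)]
      congr 1
      ext t
      ring
    rw [mcoeff2, mCoeff1]
    simp only [← eval_legendrePoly]
    rw [e2]
    ring

end TwoDimensional
section Averaging

open Polynomial MeasureTheory

lemma integral_abs_mono {f g : ℝ → ℝ} (hf : Continuous f) (hg : Continuous g)
    (h : ∀ x ∈ Set.Icc (-1:ℝ) 1, |f x| ≤ g x) :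
    |∫ x in (-1:ℝ)..1, f x| ≤ ∫ x in (-1:ℝ)..1, g x :=
  (intervalIntegral.abs_integral_le_integral_abs (by norm_num)).trans
    (intervalIntegral.integral_mono_on (by norm_num) (hf.abs.intervalIntegrable _ _)
      (hg.intervalIntegrable _ _) h)

/-- Repeated integration by parts against a function orthogonal to low-degree monomials. -/
lemma abs_integral_mul_le_of_orthogonal {n : ℕ} {q h : ℝ → ℝ} {B : ℝ} (hq : Continuous q)
    (hB : ∀ x ∈ Set.Icc (-1:ℝ) 1, |q x| ≤ B)
    (horth : ∀ j < n, ∫ x in (-1:ℝ)..1, q x * x ^ j = 0) (hh : ContDiff ℝ (⊤ : ℕ∞) h) :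
    |∫ x in (-1:ℝ)..1, q x * h x| ≤ 2 ^ n * B * ∫ x in (-1:ℝ)..1, |iteratedDeriv n h x| := by
  induction n generalizing q h B with
  | zero =>
    have hc := hh.continuous
    simp only [pow_zero, one_mul, iteratedDeriv_zero]
    rw [← intervalIntegral.integral_const_mul]
    refine integral_abs_mono (by fun_prop) (by fun_prop) fun x hx => ?_
    rw [abs_mul]
    exact mul_le_mul_of_nonneg_right (hB x hx) (abs_nonneg _)
  | succ n ih =>
    set Q : ℝ → ℝ := fun x => ∫ u in (-1:ℝ)..x, q u with hQ
    have hQd : ∀ x, HasDerivAt Q (q x) x := fun x => hq.integral_hasStrictDerivAt _ x |>.hasDerivAt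
    have hQc : Continuous Q := continuous_iff_continuousAt.2 fun x => (hQd x).continuousAt
    have hQ1 : Q 1 = 0 := by simpa using horth 0 (by omega)
    have hQ0 : Q (-1) = 0 := by simp [hQ]
    have hparts : ∀ g : ℝ → ℝ, ContDiff ℝ (⊤ : ℕ∞) g →
        ∫ x in (-1:ℝ)..1, q x * g x = ∫ x in (-1:ℝ)..1, -Q x * deriv g x := by
      intro g hg
      have := integral_mul_deriv_eq_deriv_mul (a := -1) (b := 1) (fun x _ => hQd x)
        (fun x _ => (hg.differentiable (by simp) x).hasDerivAt) (hq.intervalIntegrable _ _)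
        ((hg.continuous_deriv (by simp)).intervalIntegrable _ _)
      rw [hQ1, hQ0] at this
      simp only [neg_mul, intervalIntegral.integral_neg]
      rw [this]; ring
    have hQB : ∀ x ∈ Set.Icc (-1:ℝ) 1, |-Q x| ≤ 2 * B := by
      intro x hx
      have hB0 : 0 ≤ B := (abs_nonneg _).trans (hB x hx)
      have := intervalIntegral.norm_integral_le_of_norm_le_const (a := (-1:ℝ)) (b := x)
        (f := q) (C := B) (fun u hu => by
          rw [Set.uIoc_of_le hx.1] at hu
          exact hB u ⟨hu.1.le, hu.2.trans hx.2⟩)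
      rw [abs_neg]
      refine this.trans ?_
      rw [abs_of_nonneg (by linarith [hx.1]), mul_comm]
      exact mul_le_mul_of_nonneg_right (by linarith [hx.2]) hB0
    have := ih (q := fun x => -Q x) hQc.neg hQB (fun j hj => by
      have h1 := hparts (fun x => x ^ (j + 1)) (by fun_prop)
      rw [horth (j + 1) (by omega)] at h1
      have h2 : ∀ x : ℝ, -Q x * deriv (fun x => x ^ (j + 1)) x = (j + 1) * (-Q x * x ^ j) := by
        intro x
        rw [deriv_pow_field, Nat.add_sub_cancel]; push_cast; ring
      simp only [h2, intervalIntegral.integral_const_mul] at h1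
      exact (mul_eq_zero.1 h1.symm).resolve_left (by positivity))
      (hh.iterate_deriv 1)
    rw [hparts h hh, iteratedDeriv_succ']
    refine this.trans (le_of_eq ?_)
    rw [Function.iterate_one]
    ring

lemma segment_mem_Icc {s x ε : ℝ} (hs : s ∈ Set.Icc (-1:ℝ) 1) (hx : x ∈ Set.Icc (-1:ℝ) 1)
    (hε : ε ∈ Set.Icc (0:ℝ) 1) : (1 - ε) * s + ε * x ∈ Set.Icc (-1:ℝ) 1 :=
  (convex_Icc (-1:ℝ) 1) hs hx (by linarith [hε.2]) hε.1 (by ring)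

lemma mul_integral_dilation_le {g : ℝ → ℝ} (hg : Continuous g) (h0 : ∀ x, 0 ≤ g x) {s ε : ℝ}
    (hs : s ∈ Set.Icc (-1:ℝ) 1) (hε : ε ∈ Set.Icc (0:ℝ) 1) :
    ε * ∫ x in (-1:ℝ)..1, g ((1 - ε) * s + ε * x) ≤ ∫ x in (-1:ℝ)..1, g x := by
  rw [intervalIntegral.mul_integral_comp_add_mul]
  refine intervalIntegral.integral_mono_interval
    (segment_mem_Icc hs (x := -1) (by norm_num) hε).1 (by linarith [hε.1])
    (segment_mem_Icc hs (x := 1) (by norm_num) hε).2 (Filter.Eventually.of_forall h0)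
    (hg.intervalIntegrable _ _)

lemma sq_integral_le {g : ℝ → ℝ} (hg : Continuous g) :
    (∫ x in (-1:ℝ)..1, g x) ^ 2 ≤ 2 * ∫ x in (-1:ℝ)..1, g x ^ 2 := by
  set I := ∫ x in (-1:ℝ)..1, g x with hI
  have h : 0 ≤ ∫ x in (-1:ℝ)..1, (g x ^ 2 - I * g x + I ^ 2 / 4) :=
    intervalIntegral.integral_nonneg (by norm_num) fun x _ => by nlinarith [sq_nonneg (g x - I / 2)]
  rw [intervalIntegral.integral_add (by apply Continuous.intervalIntegrable; fun_prop)
    (by apply Continuous.intervalIntegrable; fun_prop),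
    intervalIntegral.integral_sub (by apply Continuous.intervalIntegrable; fun_prop)
    (by apply Continuous.intervalIntegrable; fun_prop), intervalIntegral.integral_const_mul,
    ← hI, intervalIntegral.integral_const, smul_eq_mul] at h
  nlinarith

lemma continuous_integral_right {G : ℝ → ℝ → ℝ} (hG : Continuous (Function.uncurry G)) :
    Continuous fun x => ∫ y in (-1:ℝ)..1, G x y :=
  intervalIntegral.continuous_parametric_intervalIntegral_of_continuous' hG _ _

lemma mul_integral_integral_dilation_le {G : ℝ → ℝ → ℝ} (hG : Continuous (Function.uncurry G))
    {s t ε : ℝ} (hs : s ∈ Set.Icc (-1:ℝ) 1) (ht : t ∈ Set.Icc (-1:ℝ) 1)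
    (hε : ε ∈ Set.Icc (0:ℝ) 1) :
    ε * ∫ y in (-1:ℝ)..1, ∫ x in (-1:ℝ)..1, |G ((1 - ε) * s + ε * x) ((1 - ε) * t + ε * y)| ≤
      2 * Real.sqrt (∫ x in (-1:ℝ)..1, ∫ y in (-1:ℝ)..1, G x y ^ 2) := by
  have hG' : Continuous fun p : ℝ × ℝ => G p.1 p.2 := hG
  have hd : Continuous fun p : ℝ × ℝ => G ((1 - ε) * s + ε * p.2) ((1 - ε) * t + ε * p.1) :=
    hG'.comp (f := fun p : ℝ × ℝ => ((1 - ε) * s + ε * p.2, (1 - ε) * t + ε * p.1)) (by fun_prop)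
  have hd1 : ∀ y, Continuous fun x => G ((1 - ε) * s + ε * x) ((1 - ε) * t + ε * y) := fun y =>
    hd.comp (Continuous.prodMk_right y)
  have hsw : Continuous fun p : ℝ × ℝ => G p.2 p.1 := hG'.comp continuous_swap
  set I := ∫ y in (-1:ℝ)..1, ∫ x in (-1:ℝ)..1, |G ((1 - ε) * s + ε * x) ((1 - ε) * t + ε * y)|
  set J := ∫ y in (-1:ℝ)..1, ∫ x in (-1:ℝ)..1, G ((1 - ε) * s + ε * x) ((1 - ε) * t + ε * y) ^ 2
    with hJ
  have h1 : I ^ 2 ≤ 4 * J := by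
    have hc : Continuous fun y => ∫ x in (-1:ℝ)..1,
        |G ((1 - ε) * s + ε * x) ((1 - ε) * t + ε * y)| :=
      continuous_integral_right (by unfold Function.uncurry; fun_prop)
    have hc2 : Continuous fun y => ∫ x in (-1:ℝ)..1,
        G ((1 - ε) * s + ε * x) ((1 - ε) * t + ε * y) ^ 2 :=
      continuous_integral_right (by unfold Function.uncurry; fun_prop)
    calc I ^ 2 ≤ 2 * ∫ y in (-1:ℝ)..1, (∫ x in (-1:ℝ)..1,
          |G ((1 - ε) * s + ε * x) ((1 - ε) * t + ε * y)|) ^ 2 := sq_integral_le hc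
      _ ≤ 2 * ∫ y in (-1:ℝ)..1, 2 * ∫ x in (-1:ℝ)..1,
          G ((1 - ε) * s + ε * x) ((1 - ε) * t + ε * y) ^ 2 := by
        refine mul_le_mul_of_nonneg_left (intervalIntegral.integral_mono_on (by norm_num)
          ((hc.pow 2).intervalIntegrable _ _) ((hc2.const_mul 2).intervalIntegrable _ _)
          fun y _ => ?_) (by norm_num)
        have := sq_integral_le (hd1 y).abs
        simpa only [sq_abs] using this
      _ = 4 * J := by rw [intervalIntegral.integral_const_mul]; ring
  have h2 : ε * (ε * J) ≤ ∫ x in (-1:ℝ)..1, ∫ y in (-1:ℝ)..1, G x y ^ 2 := by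
    rw [intervalIntegral_swap (by unfold Function.uncurry; fun_prop)]
    have hΦ : Continuous fun y => ∫ x in (-1:ℝ)..1, G x y ^ 2 :=
      continuous_integral_right (by unfold Function.uncurry; fun_prop)
    refine le_trans (mul_le_mul_of_nonneg_left ?_ hε.1)
      (mul_integral_dilation_le hΦ (fun y => intervalIntegral.integral_nonneg (by norm_num)
        fun x _ => sq_nonneg _) ht hε)
    rw [hJ, ← intervalIntegral.integral_const_mul]
    refine intervalIntegral.integral_mono_on (by norm_num) ?_ ?_ fun y _ => ?_
    · apply Continuous.intervalIntegrable
      exact (continuous_integral_right (by unfold Function.uncurry; fun_prop)).const_mul _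
    · apply Continuous.intervalIntegrable
      exact hΦ.comp (by fun_prop)
    · exact mul_integral_dilation_le
        (g := fun x => G x ((1 - ε) * t + ε * y) ^ 2)
        ((hG'.comp (Continuous.prodMk_left _)).pow 2) (fun x => sq_nonneg _) hs hε
  have h3 : (ε * I) ^ 2 ≤ 4 * ∫ x in (-1:ℝ)..1, ∫ y in (-1:ℝ)..1, G x y ^ 2 := by
    nlinarith [mul_le_mul_of_nonneg_left h1 (sq_nonneg ε)]
  refine (Real.le_sqrt_of_sq_le h3).trans (le_of_eq ?_)
  rw [Real.sqrt_mul (by norm_num), show (4:ℝ) = 2 ^ 2 by norm_num, Real.sqrt_sq (by norm_num)]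

lemma iteratedDeriv_deriv_dilation {g : ℝ → ℝ} (hg : ContDiff ℝ (⊤ : ℕ∞) g) (n : ℕ) (c ε x : ℝ) :
    iteratedDeriv n (fun x => deriv g (c + ε * x)) x =
      ε ^ n * iteratedDeriv (n + 1) g (c + ε * x) := by
  have hg' : ContDiff ℝ (⊤ : ℕ∞) (fun z => deriv g (c + z)) :=
    (hg.iterate_deriv 1).comp (contDiff_const.add contDiff_id)
  have h := congrFun (iteratedDeriv_comp_const_mul (n := n) (hg'.of_le (by exact_mod_cast le_top)) ε) x
  rw [h, iteratedDeriv_succ']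
  congr 1
  exact congrFun (iteratedDeriv_comp_const_add n (deriv g) c) _

lemma exists_bound_legendreKernel (m : ℕ) : ∃ W, 0 ≤ W ∧
    ∀ s ∈ Set.Icc (-1:ℝ) 1, ∀ x ∈ Set.Icc (-1:ℝ) 1, |legendreKernel m s x| ≤ W := by
  obtain ⟨W, hW⟩ := ((isCompact_Icc (a := (-1:ℝ)) (b := 1)).prod
    (isCompact_Icc (a := (-1:ℝ)) (b := 1))).exists_bound_of_continuousOn
    (continuous_legendreKernel m).continuousOn
  exact ⟨W, (norm_nonneg _).trans (hW (0, 0) (by simp)),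
    fun s hs x hx => hW (s, x) ⟨hs, hx⟩⟩

lemma integral_sub_mul_legendreKernel_mul_pow {n j : ℕ} (hj : j < n) (s : ℝ) :
    ∫ x in (-1:ℝ)..1, (x - s) * legendreKernel (n + 1) s x * x ^ j = 0 := by
  have h := integral_legendreKernel_mul (m := n + 1) (p := X ^ (j + 1) - C s * X ^ j) 
    (lt_of_le_of_lt (degree_le_of_natDegree_le (n := j + 1) (by compute_degree))
      (by exact_mod_cast Nat.succ_lt_succ hj)) s
  simp only [eval_sub, eval_mul, eval_pow, eval_X, eval_C] at h
  rw [show s ^ (j + 1) - s * s ^ j = 0 by ring] at h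
  rw [← h]
  congr 1
  ext x
  ring

/-- The contribution of `∂_s f` to the averaged remainder along segments. -/
lemma exists_bound_averaged_deriv {n : ℕ} (hn : 1 ≤ n) : ∃ C, 0 ≤ C ∧ ∀ f : ℝ → ℝ → ℝ,
    ContDiff ℝ (⊤ : ℕ∞) (Function.uncurry f) → ∀ s ∈ Set.Icc (-1:ℝ) 1, ∀ t ∈ Set.Icc (-1:ℝ) 1,
    ∀ ε ∈ Set.Icc (0:ℝ) 1,
    |∫ y in (-1:ℝ)..1, ∫ x in (-1:ℝ)..1, legendreKernel (n + 1) t y *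
      ((x - s) * legendreKernel (n + 1) s x *
        deriv (fun z => f z ((1 - ε) * t + ε * y)) ((1 - ε) * s + ε * x))| ≤
      C * Real.sqrt (∫ x in (-1:ℝ)..1, ∫ y in (-1:ℝ)..1,
        iteratedDeriv (n + 1) (fun z => f z y) x ^ 2) := by
  obtain ⟨W, hW0, hW⟩ := exists_bound_legendreKernel (n + 1)
  refine ⟨W * (2 ^ n * (2 * W)) * 2, by positivity, fun f hf s hs t ht ε hε => ?_⟩
  have hK : ∀ s, Continuous (legendreKernel (n + 1) s) := fun s =>
    (continuous_legendreKernel (n + 1)).comp (Continuous.prodMk_right s)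
  have hL : Continuous fun p : ℝ × ℝ => deriv (fun z => f z p.2) p.1 :=
    (contDiff_deriv_left hf).continuous
  have hm := (contDiff_iteratedDeriv_left hf (n + 1)).continuous
  have hm' : Continuous fun p : ℝ × ℝ => iteratedDeriv (n + 1) (fun z => f z p.2) p.1 := hm
  have hLc : Continuous fun p : ℝ × ℝ =>
      deriv (fun z => f z ((1 - ε) * t + ε * p.1)) ((1 - ε) * s + ε * p.2) :=
    hL.comp (f := fun p : ℝ × ℝ => ((1 - ε) * s + ε * p.2, (1 - ε) * t + ε * p.1)) (by fun_prop)
  have hmc : Continuous fun p : ℝ × ℝ =>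
      iteratedDeriv (n + 1) (fun z => f z ((1 - ε) * t + ε * p.1)) ((1 - ε) * s + ε * p.2) :=
    hm'.comp (f := fun p : ℝ × ℝ => ((1 - ε) * s + ε * p.2, (1 - ε) * t + ε * p.1)) (by fun_prop)
  have hinner : ∀ y, |∫ x in (-1:ℝ)..1, (x - s) * legendreKernel (n + 1) s x *
      deriv (fun z => f z ((1 - ε) * t + ε * y)) ((1 - ε) * s + ε * x)| ≤
      2 ^ n * (2 * W) * (ε ^ n * ∫ x in (-1:ℝ)..1,
        |iteratedDeriv (n + 1) (fun z => f z ((1 - ε) * t + ε * y)) ((1 - ε) * s + ε * x)|) := by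
    intro y
    have hg := contDiff_left hf ((1 - ε) * t + ε * y)
    have := abs_integral_mul_le_of_orthogonal (n := n) (B := 2 * W)
      (q := fun x => (x - s) * legendreKernel (n + 1) s x)
      (h := fun x => deriv (fun z => f z ((1 - ε) * t + ε * y)) ((1 - ε) * s + ε * x))
      (by have := hK s; fun_prop)
      (fun x hx => by
        rw [abs_mul]
        refine mul_le_mul ?_ (hW s hs x hx) (abs_nonneg _) (by norm_num)
        rw [abs_le]; constructor <;> linarith [hs.1, hs.2, hx.1, hx.2])
      (fun j hj => integral_sub_mul_legendreKernel_mul_pow hj s)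
      ((hg.iterate_deriv 1).comp (by fun_prop))
    simp only [iteratedDeriv_deriv_dilation hg, abs_mul, abs_of_nonneg (pow_nonneg hε.1 n)] at this
    rwa [intervalIntegral.integral_const_mul] at this
  simp only [intervalIntegral.integral_const_mul]
  set R := Real.sqrt (∫ x in (-1:ℝ)..1, ∫ y in (-1:ℝ)..1,
        iteratedDeriv (n + 1) (fun z => f z y) x ^ 2)
  have hA : Continuous fun y => ∫ x in (-1:ℝ)..1, (x - s) * legendreKernel (n + 1) s x *
      deriv (fun z => f z ((1 - ε) * t + ε * y)) ((1 - ε) * s + ε * x) :=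
    continuous_integral_right (by have := hK s; unfold Function.uncurry; fun_prop)
  have hD : Continuous fun y => ∫ x in (-1:ℝ)..1,
      |iteratedDeriv (n + 1) (fun z => f z ((1 - ε) * t + ε * y)) ((1 - ε) * s + ε * x)| :=
    continuous_integral_right (by unfold Function.uncurry; fun_prop)
  have h1 := integral_abs_mono
    (f := fun y => legendreKernel (n + 1) t y * ∫ x in (-1:ℝ)..1,
      (x - s) * legendreKernel (n + 1) s x *
      deriv (fun z => f z ((1 - ε) * t + ε * y)) ((1 - ε) * s + ε * x))
    (g := fun y => W * (2 ^ n * (2 * W)) * ε ^ n * ∫ x in (-1:ℝ)..1,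
      |iteratedDeriv (n + 1) (fun z => f z ((1 - ε) * t + ε * y)) ((1 - ε) * s + ε * x)|)
    (by have := hK t; fun_prop) (by fun_prop) (fun y hy => by
      rw [abs_mul]
      refine (mul_le_mul (hW t ht y hy) (hinner y) (abs_nonneg _) hW0).trans (le_of_eq ?_)
      ring)
  rw [intervalIntegral.integral_const_mul] at h1
  refine h1.trans ?_
  have h2 := mul_integral_integral_dilation_le hm hs ht hε
  set I := ∫ y in (-1:ℝ)..1, ∫ x in (-1:ℝ)..1,
      |iteratedDeriv (n + 1) (fun z => f z ((1 - ε) * t + ε * y)) ((1 - ε) * s + ε * x)|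
  have hI : 0 ≤ I := intervalIntegral.integral_nonneg (by norm_num) fun y _ =>
    intervalIntegral.integral_nonneg (by norm_num) fun x _ => abs_nonneg _
  have hεn : ε ^ n ≤ ε := pow_le_of_le_one hε.1 hε.2 (by omega)
  calc W * (2 ^ n * (2 * W)) * ε ^ n * I ≤ W * (2 ^ n * (2 * W)) * (ε * I) := by
        rw [mul_assoc]; gcongr
    _ ≤ W * (2 ^ n * (2 * W)) * (2 * R) := by gcongr
    _ = _ := by ring

end Averaging
section Approximation

open Polynomial MeasureTheory

lemma continuous_legendreKernel_right (m : ℕ) (s : ℝ) : Continuous (legendreKernel m s) :=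
  (continuous_legendreKernel m).comp (Continuous.prodMk_right s)

lemma integral_legendreKernel_mul_const (m : ℕ) (s c : ℝ) :
    ∫ x in (-1:ℝ)..1, legendreKernel (m + 1) s x * c = c := by
  have h := integral_legendreKernel_mul (m := m + 1) (p := C c)
    (degree_C_le.trans_lt (by exact_mod_cast Nat.succ_pos m)) s
  simpa using h

lemma exists_polynomial_integral_legendreKernel_mul (m : ℕ) {g : ℝ → ℝ} (hg : Continuous g) :
    ∃ q : ℝ[X], q.degree < m ∧
      ∀ s, ∫ x in (-1:ℝ)..1, legendreKernel m s x * g x = q.eval s := by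
  refine ⟨∑ j ∈ Finset.range m, C ((2 * (j : ℝ) + 1) / 2 *
    ∫ x in (-1:ℝ)..1, (legendrePoly j).eval x * g x) * legendrePoly j, ?_, fun s => ?_⟩
  · rw [← mem_degreeLT]
    refine Submodule.sum_mem _ fun j hj => ?_
    rw [← smul_eq_C_mul]
    refine Submodule.smul_mem _ _ (mem_degreeLT.2 ?_)
    rw [degree_legendrePoly]
    exact_mod_cast Finset.mem_range.1 hj
  · simp only [legendreKernel, Finset.sum_mul, eval_finsetSum, eval_mul, eval_C]
    rw [intervalIntegral.integral_finsetSum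
      (fun j _ => by apply Continuous.intervalIntegrable; fun_prop)]
    refine Finset.sum_congr rfl fun j _ => ?_
    simp only [mul_assoc, intervalIntegral.integral_const_mul]
    ring

/-- The `L²`-orthogonal projection of `f` onto polynomials of degree `< m` in each variable. -/
noncomputable def legendreProj2 (m : ℕ) (f : ℝ → ℝ → ℝ) (s t : ℝ) : ℝ :=
  ∫ y in (-1:ℝ)..1, ∫ x in (-1:ℝ)..1, legendreKernel m t y * (legendreKernel m s x * f x y)

variable {f : ℝ → ℝ → ℝ}

lemma hasDerivAt_segment (hf : ContDiff ℝ (⊤ : ℕ∞) (Function.uncurry f)) (s t x y ε : ℝ) :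
    HasDerivAt (fun ε => f ((1 - ε) * s + ε * x) ((1 - ε) * t + ε * y))
      ((x - s) * deriv (fun z => f z ((1 - ε) * t + ε * y)) ((1 - ε) * s + ε * x) +
        (y - t) * deriv (f ((1 - ε) * s + ε * x)) ((1 - ε) * t + ε * y)) ε := by
  have hline : ∀ a b : ℝ, HasDerivAt (fun ε : ℝ => (1 - ε) * a + ε * b) (b - a) ε := by
    intro a b
    have := (((hasDerivAt_id ε).const_sub 1).mul_const a).add ((hasDerivAt_id ε).mul_const b)
    exact this.congr_deriv (by ring)
  have h := (hf.differentiable (by simp)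
    ((1 - ε) * s + ε * x, (1 - ε) * t + ε * y)).hasFDerivAt.comp_hasDerivAt ε
    ((hline s x).prodMk (hline t y))
  refine h.congr_deriv ?_
  have hv : (x - s, y - t) = (x - s) • ((1, 0) : ℝ × ℝ) + (y - t) • ((0, 1) : ℝ × ℝ) := by simp
  rw [deriv_left_eq_fderiv hf, deriv_right_eq_fderiv hf, hv, map_add, map_smul, map_smul]
  simp only [smul_eq_mul]

lemma sqrt_left_le_seminorm2 (m : ℕ) (f : ℝ → ℝ → ℝ) :
    Real.sqrt (∫ x in (-1:ℝ)..1, ∫ y in (-1:ℝ)..1, iteratedDeriv m (fun z => f z y) x ^ 2) ≤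
      seminorm2 m f := by
  refine Real.sqrt_le_sqrt ?_
  simp only [pderiv2, iteratedDeriv_zero]
  refine le_add_of_nonneg_right ?_
  exact intervalIntegral.integral_nonneg (by norm_num) fun y _ =>
    intervalIntegral.integral_nonneg (by norm_num) fun x _ => sq_nonneg _

lemma sqrt_right_le_seminorm2 (hf : ContDiff ℝ (⊤ : ℕ∞) (Function.uncurry f)) (m : ℕ) :
    Real.sqrt (∫ y in (-1:ℝ)..1, ∫ x in (-1:ℝ)..1, iteratedDeriv m (f x) y ^ 2) ≤
      seminorm2 m f := by
  have hc : Continuous fun p : ℝ × ℝ => iteratedDeriv m (f p.2) p.1 :=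
    (contDiff_iteratedDeriv_left (contDiff_flip hf) m).continuous
  refine Real.sqrt_le_sqrt ?_
  rw [intervalIntegral_swap (F := fun y x => iteratedDeriv m (f x) y ^ 2)
    (by unfold Function.uncurry; fun_prop)]
  simp only [pderiv2, iteratedDeriv_zero]
  refine le_add_of_nonneg_left ?_
  exact intervalIntegral.integral_nonneg (by norm_num) fun y _ =>
    intervalIntegral.integral_nonneg (by norm_num) fun x _ => sq_nonneg _

/-- Uniform approximation by polynomials of degree `≤ n` in each variable, controlled by the pure
derivatives of order `n + 1` in `L²`. -/
lemma exists_bound_sub_legendreProj2 {n : ℕ} (hn : 1 ≤ n) : ∃ C, 0 ≤ C ∧ ∀ f : ℝ → ℝ → ℝ,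
    ContDiff ℝ (⊤ : ℕ∞) (Function.uncurry f) → ∀ s ∈ Set.Icc (-1:ℝ) 1, ∀ t ∈ Set.Icc (-1:ℝ) 1,
    |f s t - legendreProj2 (n + 1) f s t| ≤ C * seminorm2 (n + 1) f := by
  obtain ⟨C, hC0, hC⟩ := exists_bound_averaged_deriv hn
  refine ⟨C + C, by positivity, fun f hf s hs t ht => ?_⟩
  have hKs := continuous_legendreKernel_right (n + 1) s
  have hKt := continuous_legendreKernel_right (n + 1) t
  set D₁ : ℝ → ℝ → ℝ → ℝ := fun ε y x =>
    deriv (fun z => f z ((1 - ε) * t + ε * y)) ((1 - ε) * s + ε * x) with hD₁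
  set D₂ : ℝ → ℝ → ℝ → ℝ := fun ε y x =>
    deriv (f ((1 - ε) * s + ε * x)) ((1 - ε) * t + ε * y) with hD₂
  have hD₁c : Continuous fun p : ℝ × ℝ × ℝ => D₁ p.1 p.2.1 p.2.2 :=
    (contDiff_deriv_left hf).continuous.comp (f := fun p : ℝ × ℝ × ℝ =>
      ((1 - p.1) * s + p.1 * p.2.2, (1 - p.1) * t + p.1 * p.2.1)) (by fun_prop)
  have hD₂c : Continuous fun p : ℝ × ℝ × ℝ => D₂ p.1 p.2.1 p.2.2 :=
    (contDiff_deriv_right hf).continuous.comp (f := fun p : ℝ × ℝ × ℝ =>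
      ((1 - p.1) * s + p.1 * p.2.2, (1 - p.1) * t + p.1 * p.2.1)) (by fun_prop)
  set A : ℝ → ℝ → ℝ → ℝ := fun ε y x => legendreKernel (n + 1) t y *
    ((x - s) * legendreKernel (n + 1) s x * D₁ ε y x) with hA
  set B : ℝ → ℝ → ℝ → ℝ := fun ε y x => legendreKernel (n + 1) s x *
    ((y - t) * legendreKernel (n + 1) t y * D₂ ε y x) with hB
  have hAc : Continuous fun p : ℝ × ℝ × ℝ => A p.1 p.2.1 p.2.2 := by fun_prop
  have hBc : Continuous fun p : ℝ × ℝ × ℝ => B p.1 p.2.1 p.2.2 := by fun_prop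
  have hA2 : ∀ ε, Continuous fun p : ℝ × ℝ => A ε p.1 p.2 := fun ε =>
    hAc.comp (Continuous.prodMk_right ε)
  have hB2 : ∀ ε, Continuous fun p : ℝ × ℝ => B ε p.1 p.2 := fun ε =>
    hBc.comp (Continuous.prodMk_right ε)
  have hABc : Continuous fun p : ℝ × ℝ × ℝ => A p.1 p.2.1 p.2.2 + B p.1 p.2.1 p.2.2 :=
    hAc.add hBc
  have hfc : Continuous fun p : ℝ × ℝ => f p.1 p.2 := hf.continuous
  have hfs : Continuous fun p : ℝ × ℝ => f p.2 p.1 := hfc.comp continuous_swap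
  have hftc : ∀ y x, ∫ ε in (0:ℝ)..1, (A ε y x + B ε y x) =
      legendreKernel (n + 1) t y * (legendreKernel (n + 1) s x * f x y) -
        legendreKernel (n + 1) t y * (legendreKernel (n + 1) s x * f s t) := by
    intro y x
    have hc : Continuous fun ε => (x - s) * D₁ ε y x + (y - t) * D₂ ε y x := by
      have h1 : Continuous fun ε => D₁ ε y x := hD₁c.comp (Continuous.prodMk_left (y, x))
      have h2 : Continuous fun ε => D₂ ε y x := hD₂c.comp (Continuous.prodMk_left (y, x))
      fun_prop
    have h := intervalIntegral.integral_eq_sub_of_hasDerivAt (a := 0) (b := 1)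
      (fun ε _ => hasDerivAt_segment hf s t x y ε) (hc.intervalIntegrable _ _)
    have e : ∀ ε, A ε y x + B ε y x = legendreKernel (n + 1) t y * legendreKernel (n + 1) s x *
        ((x - s) * D₁ ε y x + (y - t) * D₂ ε y x) := fun ε => by simp only [hA, hB]; ring
    simp only [e, intervalIntegral.integral_const_mul]
    rw [h]
    simp only [sub_self, zero_mul, one_mul, zero_add, sub_zero, add_zero]
    ring
  have hconst : ∫ y in (-1:ℝ)..1, ∫ x in (-1:ℝ)..1,
      legendreKernel (n + 1) t y * (legendreKernel (n + 1) s x * f s t) = f s t := by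
    simp only [intervalIntegral.integral_const_mul, integral_legendreKernel_mul_const]
  have hdiff : legendreProj2 (n + 1) f s t - f s t =
      ∫ ε in (0:ℝ)..1, ∫ y in (-1:ℝ)..1, ∫ x in (-1:ℝ)..1, (A ε y x + B ε y x) := by
    have h1 : legendreProj2 (n + 1) f s t - f s t = ∫ y in (-1:ℝ)..1, ∫ x in (-1:ℝ)..1,
        ∫ ε in (0:ℝ)..1, (A ε y x + B ε y x) := by
      simp only [hftc]
      rw [legendreProj2]
      nth_rewrite 1 [← hconst]
      rw [← intervalIntegral.integral_sub
        (by apply Continuous.intervalIntegrable; refine continuous_integral_right ?_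
            unfold Function.uncurry; fun_prop)
        (by apply Continuous.intervalIntegrable; refine continuous_integral_right ?_
            unfold Function.uncurry; fun_prop)]
      congr 1
      ext y
      have : Continuous fun x => f x y := hfc.comp (Continuous.prodMk_left y)
      rw [← intervalIntegral.integral_sub (by apply Continuous.intervalIntegrable; fun_prop)
        (by apply Continuous.intervalIntegrable; fun_prop)]
    rw [h1, intervalIntegral_swap (F := fun ε y => ∫ x in (-1:ℝ)..1, (A ε y x + B ε y x))]
    · congr 1
      ext y
      exact intervalIntegral_swap (F := fun x ε => A ε y x + B ε y x)
        (hABc.comp (f := fun p : ℝ × ℝ => (p.2, y, p.1)) (by fun_prop)) _ _ _ _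
    · exact intervalIntegral.continuous_parametric_intervalIntegral_of_continuous'
        (f := fun (p : ℝ × ℝ) x => A p.1 p.2 x + B p.1 p.2 x)
        (hABc.comp (f := fun q : (ℝ × ℝ) × ℝ => (q.1.1, q.1.2, q.2)) (by fun_prop)) _ _
  have hbound : ∀ ε ∈ Set.Icc (0:ℝ) 1,
      |∫ y in (-1:ℝ)..1, ∫ x in (-1:ℝ)..1, (A ε y x + B ε y x)| ≤
        (C + C) * seminorm2 (n + 1) f := by
    intro ε hε
    have hsplit : ∫ y in (-1:ℝ)..1, ∫ x in (-1:ℝ)..1, (A ε y x + B ε y x) =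
        (∫ y in (-1:ℝ)..1, ∫ x in (-1:ℝ)..1, A ε y x) +
          ∫ x in (-1:ℝ)..1, ∫ y in (-1:ℝ)..1, B ε y x := by
      rw [intervalIntegral_swap (F := fun x y => B ε y x) ((hB2 ε).comp continuous_swap),
        ← intervalIntegral.integral_add ((continuous_integral_right (G := A ε) (hA2 ε)).intervalIntegrable _ _)
          ((continuous_integral_right (G := B ε) (hB2 ε)).intervalIntegrable _ _)]
      congr 1
      ext y
      exact intervalIntegral.integral_add
        (((hA2 ε).comp (Continuous.prodMk_right y)).intervalIntegrable _ _)
        (((hB2 ε).comp (Continuous.prodMk_right y)).intervalIntegrable _ _)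
    rw [hsplit, add_mul]
    refine (abs_add_le _ _).trans (add_le_add ?_ ?_)
    · exact (hC f hf s hs t ht ε hε).trans
        (mul_le_mul_of_nonneg_left (sqrt_left_le_seminorm2 _ f) hC0)
    · exact (hC (flip f) (contDiff_flip hf) t ht s hs ε hε).trans
        (mul_le_mul_of_nonneg_left (sqrt_right_le_seminorm2 hf _) hC0)
  rw [abs_sub_comm, hdiff]
  have := intervalIntegral.norm_integral_le_of_norm_le_const (a := (0:ℝ)) (b := 1)
    (f := fun ε => ∫ y in (-1:ℝ)..1, ∫ x in (-1:ℝ)..1, (A ε y x + B ε y x))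
    (C := (C + C) * seminorm2 (n + 1) f) (fun ε hε => by
      rw [Set.uIoc_of_le (by norm_num)] at hε
      exact hbound ε ⟨hε.1.le, hε.2⟩)
  simpa using this

lemma continuous_legendreProj2 (m : ℕ) (hf : Continuous (Function.uncurry f)) :
    Continuous (Function.uncurry (legendreProj2 m f)) := by
  have hK : Continuous fun p : ℝ × ℝ => legendreKernel m p.1 p.2 := continuous_legendreKernel m
  have hf' : Continuous fun p : ℝ × ℝ => f p.1 p.2 := hf
  refine intervalIntegral.continuous_parametric_intervalIntegral_of_continuous'
    (f := fun (p : ℝ × ℝ) y => ∫ x in (-1:ℝ)..1,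
      legendreKernel m p.2 y * (legendreKernel m p.1 x * f x y)) ?_ _ _
  refine intervalIntegral.continuous_parametric_intervalIntegral_of_continuous'
    (f := fun (q : (ℝ × ℝ) × ℝ) x =>
      legendreKernel m q.1.2 q.2 * (legendreKernel m q.1.1 x * f x q.2)) ?_ _ _
  have h1 : Continuous fun q : ((ℝ × ℝ) × ℝ) × ℝ => legendreKernel m q.1.1.2 q.1.2 :=
    hK.comp (f := fun q : ((ℝ × ℝ) × ℝ) × ℝ => (q.1.1.2, q.1.2)) (by fun_prop)
  have h2 : Continuous fun q : ((ℝ × ℝ) × ℝ) × ℝ => legendreKernel m q.1.1.1 q.2 :=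
    hK.comp (f := fun q : ((ℝ × ℝ) × ℝ) × ℝ => (q.1.1.1, q.2)) (by fun_prop)
  have h3 : Continuous fun q : ((ℝ × ℝ) × ℝ) × ℝ => f q.2 q.1.2 :=
    hf'.comp (f := fun q : ((ℝ × ℝ) × ℝ) × ℝ => (q.2, q.1.2)) (by fun_prop)
  exact h1.mul (h2.mul h3)

lemma legendreProj2_polynomial_right (m : ℕ) (hf : Continuous (Function.uncurry f)) (s : ℝ) :
    ∃ q : ℝ[X], q.degree < m ∧ ∀ t, legendreProj2 m f s t = q.eval t := by
  have hf' : Continuous fun p : ℝ × ℝ => f p.2 p.1 := hf.comp continuous_swap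
  have hK := continuous_legendreKernel_right m s
  obtain ⟨q, hq, h⟩ := exists_polynomial_integral_legendreKernel_mul m
    (g := fun y => ∫ x in (-1:ℝ)..1, legendreKernel m s x * f x y)
    (continuous_integral_right (by unfold Function.uncurry; fun_prop))
  refine ⟨q, hq, fun t => ?_⟩
  rw [← h]
  simp only [legendreProj2, intervalIntegral.integral_const_mul]

lemma legendreProj2_polynomial_left (m : ℕ) (hf : Continuous (Function.uncurry f)) (t : ℝ) :
    ∃ q : ℝ[X], q.degree < m ∧ ∀ s, legendreProj2 m f s t = q.eval s := by
  have hf' : Continuous fun p : ℝ × ℝ => f p.2 p.1 := hf.comp continuous_swap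
  have hf'' : Continuous fun p : ℝ × ℝ => f p.1 p.2 := hf
  have hK := continuous_legendreKernel_right m
  obtain ⟨q, hq, h⟩ := exists_polynomial_integral_legendreKernel_mul m
    (g := fun x => ∫ y in (-1:ℝ)..1, legendreKernel m t y * f x y)
    (continuous_integral_right (by have := hK t; unfold Function.uncurry; fun_prop))
  refine ⟨q, hq, fun s => ?_⟩
  have h1 := hK s
  have h2 := hK t
  rw [← h, legendreProj2, intervalIntegral_swap (by unfold Function.uncurry; fun_prop)]
  simp only [mul_left_comm (legendreKernel m t _), intervalIntegral.integral_const_mul]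

/-- The two-dimensional M-type projection expressed through `mCoeff1`. -/
noncomputable def mTypeProj2 (f : ℝ → ℝ → ℝ) (k : ℕ) (s t : ℝ) : ℝ :=
  ∑ i ∈ Finset.range (k + 1), ∑ j ∈ Finset.range (k + 1),
    mCoeff1 i (fun x => mCoeff1 j (f x)) * Mpoly i s * Mpoly j t

lemma mTypeProj2_add {g : ℝ → ℝ → ℝ} (hf : Continuous (Function.uncurry f))
    (hg : Continuous (Function.uncurry g)) (k : ℕ) (s t : ℝ) :
    mTypeProj2 (fun x y => f x y + g x y) k s t = mTypeProj2 f k s t + mTypeProj2 g k s t := by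
  have h : ∀ x j, mCoeff1 j (fun y => f x y + g x y) = mCoeff1 j (f x) + mCoeff1 j (g x) :=
    fun x j => mCoeff1_add j (hf.comp (Continuous.prodMk_right x))
      (hg.comp (Continuous.prodMk_right x))
  simp only [mTypeProj2, h, mCoeff1_add _ (continuous_mCoeff1 _ hf) (continuous_mCoeff1 _ hg),
    add_mul, Finset.sum_add_distrib]

lemma exists_bound_mTypeProj2 (k : ℕ) : ∃ K, 0 ≤ K ∧ ∀ (g : ℝ → ℝ → ℝ) (A : ℝ),
    (∀ x ∈ Set.Icc (-1:ℝ) 1, ∀ y ∈ Set.Icc (-1:ℝ) 1, |g x y| ≤ A) →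
    ∀ s ∈ Set.Icc (-1:ℝ) 1, ∀ t ∈ Set.Icc (-1:ℝ) 1, |mTypeProj2 g k s t| ≤ K * A := by
  choose K hK0 hK using exists_bound_mCoeff1
  have hM : ∀ i, ∃ D, ∀ s ∈ Set.Icc (-1:ℝ) 1, |Mpoly i s| ≤ D := fun i =>
    (isCompact_Icc (a := (-1:ℝ)) (b := 1)).exists_bound_of_continuousOn
      (continuous_Mpoly i).continuousOn
  choose D hD using hM
  have hD0 : ∀ i, 0 ≤ D i := fun i => (abs_nonneg _).trans (hD i 0 (by norm_num))
  refine ⟨∑ i ∈ Finset.range (k + 1), ∑ j ∈ Finset.range (k + 1), K i * K j * D i * D j,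
    Finset.sum_nonneg fun i _ => Finset.sum_nonneg fun j _ => ?_, fun g A hg s hs t ht => ?_⟩
  · have := hK0 i; have := hK0 j; have := hD0 i; have := hD0 j
    positivity
  · have hA : 0 ≤ A := (abs_nonneg _).trans (hg 0 (by norm_num) 0 (by norm_num))
    simp only [Finset.sum_mul, mTypeProj2]
    refine (Finset.abs_sum_le_sum_abs _ _).trans (Finset.sum_le_sum fun i _ =>
      (Finset.abs_sum_le_sum_abs _ _).trans (Finset.sum_le_sum fun j _ => ?_))
    have h := hK i (fun x => mCoeff1 j (g x)) (K j * A) fun x hx => hK j (g x) A (hg x hx)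
    rw [abs_mul, abs_mul]
    have := hK0 i; have := hK0 j; have := hD0 i
    calc _ ≤ K i * (K j * A) * D i * D j := by
          gcongr
          · exact hD i s hs
          · exact hD j t ht
      _ = _ := by ring

lemma mTypeProj2_legendreProj2 {k : ℕ} (hf : Continuous (Function.uncurry f)) {s t : ℝ}
    (hs : Mpoly (k + 1) s = 0) (ht : Mpoly (k + 1) t = 0) :
    mTypeProj2 (legendreProj2 (k + 2) f) k s t = legendreProj2 (k + 2) f s t := by
  set p := legendreProj2 (k + 2) f
  have hp : Continuous (Function.uncurry p) := continuous_legendreProj2 _ hf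
  have h1 : ∀ x, ∑ j ∈ Finset.range (k + 1), Mpoly j t * mCoeff1 j (p x) = p x t := by
    intro x
    obtain ⟨q, hq, h⟩ := legendreProj2_polynomial_right (k + 2) hf x
    have := sum_mCoeff1_mul_Mpoly hq ht
    rw [← funext h, ← h] at this
    simpa only [mul_comm] using this
  have h2 : ∑ i ∈ Finset.range (k + 1), mCoeff1 i (fun x => p x t) * Mpoly i s = p s t := by
    obtain ⟨q, hq, h⟩ := legendreProj2_polynomial_left (k + 2) hf t
    have := sum_mCoeff1_mul_Mpoly hq hs
    rwa [← funext h, ← h] at this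
  rw [← h2, mTypeProj2]
  refine Finset.sum_congr rfl fun i _ => ?_
  simp only [← h1]
  rw [mCoeff1_sum i _ fun j => (continuous_mCoeff1 j hp).const_mul _, Finset.sum_mul]
  refine Finset.sum_congr rfl fun j _ => ?_
  rw [mCoeff1_const_mul]
  ring

end Approximation

/-- For every `k ≥ 2` there is a constant `C_k` such that for every smooth
`f` on `[−1,1]²` and every tensor-product Gauss–Lobatto point `(s*,t*)` (i.e. `s*` and
`t*` are roots of `M_{k+1}`), `|f(s*,t*) − f_{k,k}(s*,t*)| ≤ C_k [f]_{k+2}`. -/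
theorem mproj2_superapproximation_at_lobatto (k : ℕ) (hk : 2 ≤ k) :
    ∃ C : ℝ, 0 < C ∧ ∀ f : ℝ → ℝ → ℝ, ContDiff ℝ (⊤ : ℕ∞) (Function.uncurry f) →
      ∀ s t : ℝ, Mpoly (k + 1) s = 0 → Mpoly (k + 1) t = 0 →
        |f s t - mproj2 f k s t| ≤ C * seminorm2 (k + 2) f := by
  obtain ⟨C, hC0, hC⟩ := exists_bound_sub_legendreProj2 (n := k + 1) (by omega)
  obtain ⟨K, hK0, hK⟩ := exists_bound_mTypeProj2 k
  refine ⟨C + K * C + 1, by positivity, fun f hf s t hs ht => ?_⟩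
  obtain ⟨l, rfl⟩ : ∃ l, k = l + 1 := ⟨k - 1, by omega⟩
  have hs' := abs_le.1 (abs_le_one_of_Mpoly_eq_zero hs)
  have ht' := abs_le.1 (abs_le_one_of_Mpoly_eq_zero ht)
  have hN : 0 ≤ seminorm2 (l + 1 + 2) f := Real.sqrt_nonneg _
  set p := legendreProj2 (l + 1 + 2) f with hp
  have hpc : Continuous (Function.uncurry p) := continuous_legendreProj2 _ hf.continuous
  have hproj : mproj2 f (l + 1) s t = mTypeProj2 (fun x y => f x y - p x y) (l + 1) s t + p s t := by
    rw [hp, ← mTypeProj2_legendreProj2 hf.continuous hs ht, ← hp,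
      ← mTypeProj2_add (f := fun x y => f x y - p x y) (g := p) (hf.continuous.sub hpc) hpc]
    simp only [sub_add_cancel, mproj2, mTypeProj2, mcoeff2_eq_mCoeff1_mCoeff1 hf]
  have h1 := hC f hf s hs' t ht'
  have h2 := hK (fun x y => f x y - p x y) _ (fun x hx y hy => hC f hf x hx y hy) s hs' t ht'
  rw [hproj, show ∀ a : ℝ, f s t - (a + p s t) = (f s t - p s t) - a by intro a; ring]
  refine (abs_sub _ _).trans ((add_le_add h1 h2).trans ?_)
  linarith
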